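/- arXiv:1802.08144 — 2 statements merged into one kernel-verified Lean document; each statement's English description precedes it below -/
import Mathlib

section
/- For every quadrangulation D of the (2s+2)-gon (vertices labelled 0,…,2s+1), the set of diagonals consisting of the diagonals of D together with, for each quadrilateral of D, its unique diagonal joining two odd vertices, is a triangulation of the (2s+2)-gon, i.e., a maximal set of pairwise non-crossing diagonals, dissecting the polygon into 2s triangles. -/
namespace FriezeNote

/-- `x` lies strictly between `a` and `b`, going in the positive direction
around the vertices `0, 1, …, m-1` of the `m`-gon. -/
def StrictBtw (m : ℕ) (a x b : ZMod m) : Prop :=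
  0 < (x - a).val ∧ (x - a).val < (b - a).val

/-- Two chords of the `m`-gon cross (in the interior of the polygon). -/
def Crosses (m : ℕ) (e f : Sym2 (ZMod m)) : Prop :=
  ∃ a b c d : ZMod m, e = s(a, b) ∧ f = s(c, d) ∧
    StrictBtw m a c b ∧ StrictBtw m b d a

/-- `e` is a diagonal of the `m`-gon: its endpoints are distinct and non-adjacent. -/
def IsDiagonal (m : ℕ) (e : Sym2 (ZMod m)) : Prop :=
  ∃ a b : ZMod m, e = s(a, b) ∧ a ≠ b ∧ b ≠ a + 1 ∧ a ≠ b + 1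

/-- `e` is a boundary edge of the `m`-gon. -/
def IsPolyEdge (m : ℕ) (e : Sym2 (ZMod m)) : Prop :=
  ∃ a : ZMod m, e = s(a, a + 1)

/-- A dissection of the `m`-gon: a set of pairwise non-crossing diagonals. -/
def IsDissection (m : ℕ) (D : Set (Sym2 (ZMod m))) : Prop :=
  (∀ e ∈ D, IsDiagonal m e) ∧ ∀ e ∈ D, ∀ f ∈ D, ¬ Crosses m e f

/-- `b` is the cyclic successor of `a` among the vertices of the finite set `C`:
both lie in `C` and no element of `C` lies strictly between them. -/
def CycConsec (m : ℕ) (C : Finset (ZMod m)) (a b : ZMod m) : Prop :=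
  a ∈ C ∧ b ∈ C ∧ a ≠ b ∧ ∀ x ∈ C, ¬ StrictBtw m a x b

/-- `C` is the vertex set of one of the subpolygons (cells) into which the
dissection `D` splits the `m`-gon: it has at least `3` vertices, cyclically
consecutive vertices of `C` are joined by a diagonal of `D` or a boundary edge,
and any diagonal of `D` with both endpoints in `C` joins cyclically consecutive
vertices of `C`. -/
def IsCell (m : ℕ) (D : Set (Sym2 (ZMod m))) (C : Finset (ZMod m)) : Prop :=
  3 ≤ C.card ∧
  (∀ a b : ZMod m, CycConsec m C a b → (s(a, b) ∈ D ∨ IsPolyEdge m s(a, b))) ∧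
  (∀ a b : ZMod m, a ∈ C → b ∈ C → s(a, b) ∈ D →
    (CycConsec m C a b ∨ CycConsec m C b a))

/-- `D` is a `p`-angulation of the `m`-gon: a dissection all of whose
subpolygons are `p`-gons. -/
def IsPAngulation (m p : ℕ) (D : Set (Sym2 (ZMod m))) : Prop :=
  IsDissection m D ∧ ∀ C : Finset (ZMod m), IsCell m D C → C.card = p

/-- The number of subpolygons of the dissection `D` incident with the vertex `α`. -/
noncomputable def cellCount (m : ℕ) (D : Set (Sym2 (ZMod m))) (α : ZMod m) : ℕ :=
  {C : Finset (ZMod m) | IsCell m D C ∧ α ∈ C}.ncard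

/-- A frieze pattern of width `n`: rows numbered `0, …, n + 3` from below (entries
of rows beyond `n + 3` are irrelevant), each row indexed by `ℤ`, rows `0` and
`n + 3` are zeroes, rows `1` and `n + 2` are ones, rows `2` through `n + 1` are
positive, and every diamond `b` (top), `a` (left), `d` (right), `c` (bottom)
satisfies `a * d - b * c = 1`. -/
structure Frieze (n : ℕ) where
  entry : ℕ → ℤ → ℝ
  nonneg : ∀ i k, i ≤ n + 3 → 0 ≤ entry i k
  row_zero : ∀ k, entry 0 k = 0
  row_top : ∀ k, entry (n + 3) k = 0
  row_one : ∀ k, entry 1 k = 1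
  row_penult : ∀ k, entry (n + 2) k = 1
  row_pos : ∀ i k, 2 ≤ i → i ≤ n + 1 → 0 < entry i k
  diamond : ∀ i k, 1 ≤ i → i ≤ n + 2 →
    entry i k * entry i (k + 1) - entry (i + 1) k * entry (i - 1) (k + 1) = 1

/-- `λ_p = 2 cos (π / p)`. -/
noncomputable def lambda (p : ℕ) : ℝ := 2 * Real.cos (Real.pi / p)

/-- A frieze pattern is of type `Λ_p` if every entry of its quiddity row (row `2`)
is a positive integral multiple of `λ_p`. -/
def IsTypeLambda (p : ℕ) {n : ℕ} (F : Frieze n) : Prop :=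
  ∀ k : ℤ, ∃ q : ℕ, 0 < q ∧ F.entry 2 k = (q : ℝ) * lambda p

/-- `F` is the frieze of type `Λ_p` associated to the `p`-angulation `D` of the
`m`-gon: its quiddity row is the periodic sequence `(λ_p q_0, …, λ_p q_{m-1})`. -/
def FriezeOfPAng (p m : ℕ) {n : ℕ} (F : Frieze n) (D : Set (Sym2 (ZMod m))) : Prop :=
  ∀ k : ℤ, F.entry 2 k = lambda p * (cellCount m D (k : ZMod m) : ℝ)

/-- `F` is the Conway–Coxeter frieze of the triangulation `T` of the `m`-gon:
its quiddity row is the periodic sequence `(t_0, …, t_{m-1})` where `t_α` is the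
number of triangles of `T` incident with the vertex `α`. -/
def CCFrieze (m : ℕ) {n : ℕ} (F : Frieze n) (T : Set (Sym2 (ZMod m))) : Prop :=
  ∀ k : ℤ, F.entry 2 k = (cellCount m T (k : ZMod m) : ℝ)

/-- A vertex of the `m`-gon is black when its label is odd (vertices are coloured
alternately, odd vertices black and even vertices white). -/
def IsBlack (m : ℕ) (a : ZMod m) : Prop := a.val % 2 = 1

/-- The set of chords joining two distinct black (odd) vertices of a common
subpolygon of the dissection `D`. -/
def oddPairs (m : ℕ) (D : Set (Sym2 (ZMod m))) : Set (Sym2 (ZMod m)) :=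
  {e | ∃ (C : Finset (ZMod m)) (a b : ZMod m),
    IsCell m D C ∧ e = s(a, b) ∧ a ∈ C ∧ b ∈ C ∧ a ≠ b ∧ IsBlack m a ∧ IsBlack m b}

/-- The triangulation associated to a dissection `D`: the diagonals of `D`
together with, inside each subpolygon, the chords joining pairs of its odd
(black) vertices. -/
def assocTriangulation (m : ℕ) (D : Set (Sym2 (ZMod m))) : Set (Sym2 (ZMod m)) :=
  D ∪ oddPairs m D

/-- `E` is a noncrossing tree on the black (odd) vertices of the `m`-gon:
its edges join distinct black vertices, are pairwise non-crossing, any two black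
vertices are connected by a sequence of edges, and there is no loop of edges. -/
def IsNoncrossingTree (m : ℕ) (E : Set (Sym2 (ZMod m))) : Prop :=
  (∀ e ∈ E, ∃ a b : ZMod m, e = s(a, b) ∧ a ≠ b ∧ IsBlack m a ∧ IsBlack m b) ∧
  (∀ e ∈ E, ∀ f ∈ E, ¬ Crosses m e f) ∧
  (∀ a b : ZMod m, IsBlack m a → IsBlack m b →
    (SimpleGraph.fromEdgeSet E).Reachable a b) ∧
  (SimpleGraph.fromEdgeSet E).IsAcyclic

/-- The inverse of the tree-of-quadrangulation map: it sends a noncrossing tree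
`E` to the set of all black–white diagonals crossing no edge of `E`. -/
def quadOfTree (m : ℕ) (E : Set (Sym2 (ZMod m))) : Set (Sym2 (ZMod m)) :=
  {e | IsDiagonal m e ∧
    (∃ a b : ZMod m, e = s(a, b) ∧ IsBlack m a ∧ ¬ IsBlack m b) ∧
    ∀ f ∈ E, ¬ Crosses m e f}

/-- `e` is a diagonal of the subpolygon with vertex set `C`: both endpoints are
distinct vertices of `C` which are not cyclically consecutive in `C`. -/
def CellDiagonal (m : ℕ) (C : Finset (ZMod m)) (e : Sym2 (ZMod m)) : Prop :=
  ∃ a b : ZMod m, e = s(a, b) ∧ a ∈ C ∧ b ∈ C ∧ a ≠ b ∧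
    ¬ CycConsec m C a b ∧ ¬ CycConsec m C b a

/-- `e` is an edge of the subpolygon with vertex set `C`: it joins two
cyclically consecutive vertices of `C`. -/
def CellEdge (m : ℕ) (C : Finset (ZMod m)) (e : Sym2 (ZMod m)) : Prop :=
  ∃ a b : ZMod m, e = s(a, b) ∧ (CycConsec m C a b ∨ CycConsec m C b a)

/-- `C` is an ear of the dissection `D`: a subpolygon all of whose edges except
exactly one are boundary edges of the polygon. -/
def IsEar (m : ℕ) (D : Set (Sym2 (ZMod m))) (C : Finset (ZMod m)) : Prop :=
  IsCell m D C ∧ ∃! e : Sym2 (ZMod m), CellEdge m C e ∧ ¬ IsPolyEdge m e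

/-- The dual graph of a dissection `D`: vertices are the subpolygons of `D`, and
two subpolygons are adjacent when they share a common edge (a diagonal of `D`). -/
def dualGraph (m : ℕ) (D : Set (Sym2 (ZMod m))) :
    SimpleGraph {C : Finset (ZMod m) // IsCell m D C} :=
  SimpleGraph.fromRel fun C C' =>
    ∃ e ∈ D, ∃ a b : ZMod m, e = s(a, b) ∧
      a ∈ C.1 ∧ b ∈ C.1 ∧ a ∈ C'.1 ∧ b ∈ C'.1

section helpers
variable {m : ℕ} [NeZero m]

lemma sub_val (x a : ZMod m) :
    (x - a).val = if a.val ≤ x.val then x.val - a.val else x.val + m - a.val := by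
  split_ifs with h
  · exact ZMod.val_sub h
  · have h1 : (a - x).val = a.val - x.val := ZMod.val_sub (by omega)
    have h2 : x - a = -(a - x) := by ring
    rw [h2, ZMod.neg_val]
    have := ZMod.val_lt a
    split_ifs with h3
    · rw [h3] at h1; simp at h1; omega
    · omega

lemma sb_iff (a x b : ZMod m) : StrictBtw m a x b ↔
    (a.val < x.val ∧ x.val < b.val) ∨ (x.val < b.val ∧ b.val < a.val) ∨
      (b.val < a.val ∧ a.val < x.val) := by
  unfold StrictBtw
  rw [sub_val, sub_val]
  have := ZMod.val_lt a
  have := ZMod.val_lt b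
  have := ZMod.val_lt x
  split_ifs <;> omega

lemma crosses_iff (a b c d : ZMod m) (h1 : a.val < b.val) (h2 : c.val < d.val) :
    Crosses m s(a, b) s(c, d) ↔
      (a.val < c.val ∧ c.val < b.val ∧ b.val < d.val) ∨
      (c.val < a.val ∧ a.val < d.val ∧ d.val < b.val) := by
  constructor
  · rintro ⟨a', b', c', d', he, hf, h3, h4⟩
    rw [sb_iff] at h3 h4
    rw [Sym2.eq_iff] at he hf
    rcases he with ⟨rfl, rfl⟩ | ⟨rfl, rfl⟩ <;> rcases hf with ⟨rfl, rfl⟩ | ⟨rfl, rfl⟩ <;> omega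
  · rintro (h | h)
    · exact ⟨a, b, c, d, rfl, rfl, by rw [sb_iff]; omega, by rw [sb_iff]; omega⟩
    · exact ⟨a, b, d, c, rfl, Sym2.eq_swap, by rw [sb_iff]; omega, by rw [sb_iff]; omega⟩

lemma val_succ (hm : 3 ≤ m) (a : ZMod m) :
    (a + 1).val = if a.val + 1 = m then 0 else a.val + 1 := by
  have := ZMod.val_lt a
  rw [ZMod.val_add, ZMod.val_one'' (by omega)]
  split_ifs with h
  · rw [h]; simp
  · exact Nat.mod_eq_of_lt (by omega)

lemma eq_succ_iff (hm : 3 ≤ m) (a b : ZMod m) : b = a + 1 ↔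
    (b.val = a.val + 1 ∨ (b.val = 0 ∧ a.val + 1 = m)) := by
  rw [← (ZMod.val_injective m).eq_iff, val_succ hm]
  have := ZMod.val_lt b
  split_ifs <;> omega

lemma poly_iff (hm : 3 ≤ m) (a b : ZMod m) (h : a.val < b.val) :
    IsPolyEdge m s(a, b) ↔ b.val = a.val + 1 ∨ (a.val = 0 ∧ b.val + 1 = m) := by
  constructor
  · rintro ⟨c, hc⟩
    rw [Sym2.eq_iff] at hc
    rcases hc with ⟨rfl, h1⟩ | ⟨h1, rfl⟩
    · rw [eq_succ_iff hm] at h1; omega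
    · rw [eq_succ_iff hm] at h1; omega
  · rintro (h1 | h1)
    · exact ⟨a, by rw [Sym2.eq_iff]; left; refine ⟨rfl, ?_⟩; rw [eq_succ_iff hm]; omega⟩
    · exact ⟨b, by rw [Sym2.eq_iff]; right; refine ⟨?_, rfl⟩; rw [eq_succ_iff hm]; omega⟩

lemma diag_iff (hm : 3 ≤ m) (a b : ZMod m) (h : a.val < b.val) :
    IsDiagonal m s(a, b) ↔ ¬ (b.val = a.val + 1 ∨ (a.val = 0 ∧ b.val + 1 = m)) := by
  constructor
  · rintro ⟨c, d, hc, h1, h2, h3⟩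
    rw [ne_eq, eq_succ_iff hm] at h2 h3
    rw [Sym2.eq_iff] at hc
    rcases hc with ⟨rfl, rfl⟩ | ⟨rfl, rfl⟩ <;> omega
  · intro h1
    refine ⟨a, b, rfl, ?_, ?_, ?_⟩
    · rintro rfl; omega
    · rw [ne_eq, eq_succ_iff hm]; omega
    · rw [ne_eq, eq_succ_iff hm]; omega

lemma sym2_sorted {e : Sym2 (ZMod m)} (h : IsDiagonal m e) :
    ∃ a b : ZMod m, e = s(a, b) ∧ a.val < b.val := by
  obtain ⟨a, b, rfl, h1, -⟩ := h
  have : a.val ≠ b.val := fun h => h1 (ZMod.val_injective m h)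
  rcases lt_or_gt_of_ne this with h | h
  · exact ⟨a, b, rfl, h⟩
  · exact ⟨b, a, Sym2.eq_swap, h⟩

/-- chord of `D` or boundary edge -/
def Lk (m : ℕ) (D : Set (Sym2 (ZMod m))) (a b : ZMod m) : Prop :=
  s(a, b) ∈ D ∨ IsPolyEdge m s(a, b)

lemma lk_noncross (hm : 3 ≤ m) {D : Set (Sym2 (ZMod m))} (hD : IsDissection m D)
    {a b c d : ZMod m} (h1 : Lk m D a b) (h2 : Lk m D c d)
    (hac : a.val < c.val) (hcb : c.val < b.val) (hbd : b.val < d.val) : False := by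
  have := ZMod.val_lt d
  rcases h1 with h1 | h1
  · rcases h2 with h2 | h2
    · exact hD.2 _ h1 _ h2 ((crosses_iff a b c d (by omega) (by omega)).2 (by omega))
    · rw [poly_iff hm _ _ (by omega)] at h2; omega
  · rw [poly_iff hm _ _ (by omega)] at h1; omega

lemma cell_consec {D : Set (Sym2 (ZMod m))} {C : Finset (ZMod m)} (hC : IsCell m D C)
    {a b : ZMod m} (ha : a ∈ C) (hb : b ∈ C) (hab : a.val < b.val)
    (h : ∀ x ∈ C, ¬ (a.val < x.val ∧ x.val < b.val)) : Lk m D a b := by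
  refine hC.2.1 a b ⟨ha, hb, ?_, ?_⟩
  · rintro rfl; omega
  · intro x hx; rw [sb_iff]; have := h x hx; omega

lemma cell_minmax {D : Set (Sym2 (ZMod m))} {C : Finset (ZMod m)} (hC : IsCell m D C)
    {a b : ZMod m} (ha : a ∈ C) (hb : b ∈ C) (hab : a.val < b.val)
    (h : ∀ x ∈ C, a.val ≤ x.val ∧ x.val ≤ b.val) : Lk m D a b := by
  have := hC.2.1 b a ⟨hb, ha, ?_, ?_⟩
  · unfold Lk; rw [Sym2.eq_swap]; exact this
  · rintro rfl; omega
  · intro x hx; rw [sb_iff]; have := h x hx; omega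

lemma cell_diag {D : Set (Sym2 (ZMod m))} {C : Finset (ZMod m)} (hC : IsCell m D C)
    {a b : ZMod m} (ha : a ∈ C) (hb : b ∈ C) (hab : a.val < b.val) (h : s(a, b) ∈ D) :
    (∀ x ∈ C, ¬ (a.val < x.val ∧ x.val < b.val)) ∨ (∀ x ∈ C, a.val ≤ x.val ∧ x.val ≤ b.val) := by
  rcases hC.2.2 a b ha hb h with ⟨-, -, -, h⟩ | ⟨-, -, -, h⟩
  · left; intro x hx; have := h x hx; rw [sb_iff] at this; omega
  · right; intro x hx; have := h x hx; rw [sb_iff] at this; omega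

lemma gap {C : Finset (ZMod m)} {a b p : ZMod m} (ha : a ∈ C) (hb : b ∈ C)
    (hap : a.val < p.val) (hpb : p.val < b.val) (hp : p ∉ C) :
    ∃ u ∈ C, ∃ w ∈ C, u.val < p.val ∧ p.val < w.val ∧ a.val ≤ u.val ∧ w.val ≤ b.val ∧
      ∀ x ∈ C, ¬ (u.val < x.val ∧ x.val < w.val) := by
  obtain ⟨u, hu, hu'⟩ := Finset.exists_max_image (C.filter (fun x => x.val < p.val)) ZMod.val
    ⟨a, by simp [ha, hap]⟩
  obtain ⟨w, hw, hw'⟩ := Finset.exists_min_image (C.filter (fun x => p.val < x.val)) ZMod.val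
    ⟨b, by simp [hb, hpb]⟩
  simp only [Finset.mem_filter] at hu hw hu' hw'
  refine ⟨u, hu.1, w, hw.1, hu.2, hw.2, hu' a ⟨ha, hap⟩, hw' b ⟨hb, hpb⟩, ?_⟩
  intro x hx h
  rcases lt_trichotomy x.val p.val with h1 | h1 | h1
  · have := hu' x ⟨hx, h1⟩; omega
  · exact hp (ZMod.val_injective m h1 ▸ hx)
  · have := hw' x ⟨hx, h1⟩; omega

lemma tri_isCell {D : Set (Sym2 (ZMod m))} {a p b : ZMod m}
    (hap : a.val < p.val) (hpb : p.val < b.val) (h1 : Lk m D a p) (h2 : Lk m D p b)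
    (h3 : Lk m D a b) (hm : 3 ≤ m) (hD : IsDissection m D) : IsCell m D {a, p, b} := by
  have n1 : a ≠ p := by rintro rfl; omega
  have n2 : a ≠ b := by rintro rfl; omega
  have n3 : p ≠ b := by rintro rfl; omega
  refine ⟨by rw [Finset.card_eq_three.2 ⟨a, p, b, n1, n2, n3, rfl⟩], ?_, ?_⟩
  · rintro x y ⟨hx, hy, hxy, -⟩
    simp only [Finset.mem_insert, Finset.mem_singleton] at hx hy
    have h1' : Lk m D p a := by unfold Lk; rw [Sym2.eq_swap]; exact h1
    have h2' : Lk m D b p := by unfold Lk; rw [Sym2.eq_swap]; exact h2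
    have h3' : Lk m D b a := by unfold Lk; rw [Sym2.eq_swap]; exact h3
    rcases hx with rfl | rfl | rfl <;> rcases hy with rfl | rfl | rfl <;>
      first | exact absurd rfl hxy | assumption
  · intro x y hx hy hxy
    have hne : x ≠ y := by
      rintro rfl
      obtain ⟨c, d, h, h', -⟩ := hD.1 _ hxy
      rw [Sym2.eq_iff] at h
      rcases h with ⟨rfl, rfl⟩ | ⟨rfl, rfl⟩ <;> exact h' rfl
    unfold CycConsec
    simp only [sb_iff]
    simp only [Finset.mem_insert, Finset.mem_singleton] at hx hy ⊢
    rcases hx with rfl | rfl | rfl <;> rcases hy with rfl | rfl | rfl <;>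
      first
      | exact absurd rfl hne
      | (left; refine ⟨by simp, by simp, hne, ?_⟩; rintro z (rfl | rfl | rfl) <;> omega)
      | (right; refine ⟨by simp, by simp, hne.symm, ?_⟩; rintro z (rfl | rfl | rfl) <;> omega)

lemma cell_below (hm : 3 ≤ m) {D : Set (Sym2 (ZMod m))} (hD : IsDissection m D)
    {a b : ZMod m} (hab : a.val + 1 < b.val) (hL : Lk m D a b) :
    ∃ C, IsCell m D C ∧ a ∈ C ∧ b ∈ C ∧ ∀ x ∈ C, a.val ≤ x.val ∧ x.val ≤ b.val := by
  classical
  let Cov (x c d : ZMod m) : Prop := s(c, d) ∈ D ∧ a.val ≤ c.val ∧ d.val ≤ b.val ∧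
    ¬ (c.val = a.val ∧ d.val = b.val) ∧ c.val < x.val ∧ x.val < d.val
  let C : Finset (ZMod m) := Finset.univ.filter
    (fun x => a.val ≤ x.val ∧ x.val ≤ b.val ∧ ∀ c d, ¬ Cov x c d)
  have memC : ∀ x, x ∈ C ↔ a.val ≤ x.val ∧ x.val ≤ b.val ∧ ∀ c d, ¬ Cov x c d := by
    intro x; simp [C]
  have haC : a ∈ C := by
    rw [memC]; refine ⟨le_rfl, by omega, ?_⟩
    rintro c d ⟨-, h⟩; omega
  have hbC : b ∈ C := by
    rw [memC]; refine ⟨by omega, le_rfl, ?_⟩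
    rintro c d ⟨-, h⟩; omega
  -- successor step
  have step : ∀ x ∈ C, x.val < b.val → ∃ y ∈ C, x.val < y.val ∧ Lk m D x y ∧
      ¬ (x.val = a.val ∧ y.val = b.val) ∧ ∀ z ∈ C, ¬ (x.val < z.val ∧ z.val < y.val) := by
    intro x hx hxb
    have hbm := ZMod.val_lt b
    have hv : (x + 1).val = x.val + 1 := by rw [val_succ hm, if_neg (by omega)]
    have hx' := (memC x).1 hx
    by_cases hc : x + 1 ∈ C
    · refine ⟨x + 1, hc, by omega, Or.inr ⟨x, rfl⟩, by omega, fun z _ => by omega⟩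
    · rw [memC] at hc
      push Not at hc
      obtain ⟨c, d, h1, h2, h3, h4, h5, h6⟩ := hc (by omega) (by omega)
      have hcx : c = x := by
        apply ZMod.val_injective m
        by_contra hne
        exact hx'.2.2 c d ⟨h1, h2, h3, h4, by omega, by omega⟩
      subst hcx
      obtain ⟨y, hy, hymax⟩ := Finset.exists_max_image
        (Finset.univ.filter (fun y => Cov (c + 1) c y)) ZMod.val
        ⟨d, by simp only [Finset.mem_filter, Finset.mem_univ, true_and]
               exact ⟨h1, h2, h3, h4, h5, h6⟩⟩
      simp only [Finset.mem_filter, Finset.mem_univ, true_and] at hy hymax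
      obtain ⟨g1, g2, g3, g4, g5, g6⟩ := hy
      refine ⟨y, ?_, by omega, Or.inl g1, g4, ?_⟩
      · rw [memC]
        refine ⟨by omega, g3, ?_⟩
        rintro c' d' ⟨k1, k2, k3, k4, k5, k6⟩
        rcases lt_trichotomy c'.val c.val with h | h | h
        · exact hx'.2.2 c' d' ⟨k1, k2, k3, k4, by omega, by omega⟩
        · have h' := ZMod.val_injective m h
          subst h'
          have := hymax d' ⟨k1, k2, k3, k4, by omega, by omega⟩
          omega
        · exact lk_noncross hm hD (Or.inl g1) (Or.inl k1) h k5 k6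
      · intro z hz h
        exact ((memC z).1 hz).2.2 c y ⟨g1, g2, g3, g4, h.1, h.2⟩
  refine ⟨C, ⟨?_, ?_, ?_⟩, haC, hbC, fun x hx => ⟨((memC x).1 hx).1, ((memC x).1 hx).2.1⟩⟩
  · obtain ⟨y, hy, h1, -, h2, -⟩ := step a haC (by omega)
    have := ((memC y).1 hy).2.1
    have hsub : ({a, y, b} : Finset (ZMod m)) ⊆ C := by
      intro z; simp only [Finset.mem_insert, Finset.mem_singleton]
      rintro (rfl | rfl | rfl) <;> assumption
    refine le_trans ?_ (Finset.card_le_card hsub)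
    rw [Finset.card_eq_three.2 ⟨a, y, b, ?_, ?_, ?_, rfl⟩] <;> (rintro rfl; omega)
  · rintro x y ⟨hx, hy, hxy, h⟩
    simp only [sb_iff] at h
    have hne : x.val ≠ y.val := fun h => hxy (ZMod.val_injective m h)
    have hx' := (memC x).1 hx
    have hy' := (memC y).1 hy
    rcases lt_or_gt_of_ne hne with hlt | hlt
    · obtain ⟨y', k1, k2, k3, -, k5⟩ := step x hx (by omega)
      have : y' = y := by
        apply ZMod.val_injective m
        have := h y' k1
        have := k5 y hy
        omega
      exact this ▸ k3
    · have h1 := h a haC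
      have h2 := h b hbC
      have e1 : x = b := ZMod.val_injective m (by omega)
      have e2 : y = a := ZMod.val_injective m (by omega)
      subst e1 e2
      rw [Sym2.eq_swap]; exact hL
  · intro x y hx hy hxy
    wlog hlt : x.val < y.val generalizing x y
    · have hne : x.val ≠ y.val := by
        intro h
        have h' := ZMod.val_injective m h
        subst h'
        obtain ⟨c, d, h, h', -⟩ := hD.1 _ hxy
        rw [Sym2.eq_iff] at h
        rcases h with ⟨rfl, rfl⟩ | ⟨rfl, rfl⟩ <;> exact h' rfl
      exact (this y x hy hx (by rw [Sym2.eq_swap]; exact hxy) (by omega)).symm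
    have hne : x ≠ y := by rintro rfl; omega
    have hx' := (memC x).1 hx
    have hy' := (memC y).1 hy
    by_cases hc : x.val = a.val ∧ y.val = b.val
    · right
      refine ⟨hy, hx, hne.symm, ?_⟩
      intro z hz; have := (memC z).1 hz; rw [sb_iff]; omega
    · left
      refine ⟨hx, hy, hne, ?_⟩
      intro z hz h; rw [sb_iff] at h
      exact ((memC z).1 hz).2.2 x y ⟨hxy, hx'.1, hy'.2.1, hc, by omega, by omega⟩

/-- every link that is not a short edge bounds a triangle below -/
def Tri (m : ℕ) (T : Set (Sym2 (ZMod m))) : Prop :=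
  ∀ a b : ZMod m, a.val + 1 < b.val → Lk m T a b →
    ∃ p : ZMod m, a.val < p.val ∧ p.val < b.val ∧ Lk m T a p ∧ Lk m T p b

lemma cell_of_tri (hm : 3 ≤ m) {T : Set (Sym2 (ZMod m))} (hT : IsDissection m T)
    (hTri : Tri m T) {C : Finset (ZMod m)} (hC : IsCell m T C) :
    ∃ a p b : ZMod m, a.val < p.val ∧ p.val < b.val ∧ Lk m T a p ∧ Lk m T p b ∧ Lk m T a b ∧
      C = {a, p, b} := by
  have hcard := hC.1
  have hne : C.Nonempty := Finset.card_pos.1 (by omega)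
  obtain ⟨a, ha, hamin⟩ := Finset.exists_min_image C ZMod.val hne
  obtain ⟨b, hb, hbmax⟩ := Finset.exists_max_image C ZMod.val hne
  have hab0 := hamin b hb
  obtain ⟨c, hc, hca, hcb⟩ : ∃ c ∈ C, c ≠ a ∧ c ≠ b := by
    by_contra hcon
    push Not at hcon
    have : C ⊆ {a, b} := by
      intro z hz
      simp only [Finset.mem_insert, Finset.mem_singleton]
      by_contra h
      push Not at h
      exact h.2 (hcon z hz h.1)
    have := (Finset.card_le_card this).trans (Finset.card_le_two)
    omega
  have hca' : c.val ≠ a.val := fun h => hca (ZMod.val_injective m h)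
  have hcb' : c.val ≠ b.val := fun h => hcb (ZMod.val_injective m h)
  have hc1 := hamin c hc
  have hc2 := hbmax c hc
  have hLab := cell_minmax hC ha hb (by omega) (fun x hx => ⟨hamin x hx, hbmax x hx⟩)
  obtain ⟨p, hap, hpb, h1, h2⟩ := hTri a b (by omega) hLab
  have hp : p ∈ C := by
    by_contra hp
    obtain ⟨u, hu, w, hw, k1, k2, k3, k4, k5⟩ := gap ha hb hap hpb hp
    have hL := cell_consec hC hu hw (by omega) k5
    rcases Nat.lt_or_ge a.val u.val with h | h
    · exact lk_noncross hm hT h1 hL h k1 k2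
    · rcases Nat.lt_or_ge w.val b.val with h' | h'
      · exact lk_noncross hm hT hL h2 k1 k2 h'
      · exact k5 c hc (by omega)
  refine ⟨a, p, b, hap, hpb, h1, h2, hLab, ?_⟩
  have bm := ZMod.val_lt b
  have key1 : ∀ x ∈ C, ¬ (a.val < x.val ∧ x.val < p.val) := by
    rcases h1 with h | h
    · rcases cell_diag hC ha hp hap h with h | h
      · exact h
      · have := h b hb; omega
    · rw [poly_iff hm _ _ hap] at h
      intro x hx; omega
  have key2 : ∀ x ∈ C, ¬ (p.val < x.val ∧ x.val < b.val) := by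
    rcases h2 with h | h
    · rcases cell_diag hC hp hb hpb h with h | h
      · exact h
      · have := h a ha; omega
    · rw [poly_iff hm _ _ hpb] at h
      intro x hx; omega
  ext x
  simp only [Finset.mem_insert, Finset.mem_singleton]
  constructor
  · intro hx
    have := key1 x hx
    have := key2 x hx
    have := hamin x hx
    have := hbmax x hx
    rw [← (ZMod.val_injective m).eq_iff, ← (ZMod.val_injective m).eq_iff,
      ← (ZMod.val_injective m).eq_iff]
    omega
  · rintro (rfl | rfl | rfl) <;> assumption

lemma tri_maximal (hm : 3 ≤ m) {T : Set (Sym2 (ZMod m))}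
    (hTri : Tri m T) {c d : ZMod m} (hcd : c.val < d.val) (hdiag : IsDiagonal m s(c, d))
    (hnc : ∀ e ∈ T, ¬ Crosses m e s(c, d)) (n : ℕ) :
    ∀ a b : ZMod m, b.val - a.val = n → Lk m T a b → a.val ≤ c.val → d.val ≤ b.val →
      s(c, d) ∈ T := by
  rw [diag_iff hm _ _ hcd] at hdiag
  induction n using Nat.strong_induction_on with
  | _ n ih =>
    intro a b hn hL hac hdb
    have bm := ZMod.val_lt b
    by_cases heq : a.val = c.val ∧ d.val = b.val
    · have e1 : a = c := ZMod.val_injective m heq.1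
      have e2 : d = b := ZMod.val_injective m heq.2
      subst e1 e2
      rcases hL with h | h
      · exact h
      · rw [poly_iff hm _ _ hcd] at h; exact absurd h hdiag
    · obtain ⟨p, hap, hpb, h1, h2⟩ := hTri a b (by omega) hL
      rcases Nat.lt_or_ge c.val p.val with h | h
      · rcases Nat.lt_or_ge p.val d.val with h' | h'
        · exfalso
          rcases Nat.lt_or_ge a.val c.val with g | g
          · rcases h1 with h1 | h1
            · exact hnc _ h1 ((crosses_iff _ _ _ _ hap hcd).2 (by omega))
            · rw [poly_iff hm _ _ hap] at h1; omega
          · rcases h2 with h2 | h2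
            · exact hnc _ h2 ((crosses_iff _ _ _ _ hpb hcd).2 (by omega))
            · rw [poly_iff hm _ _ hpb] at h2; omega
        · exact ih _ (by omega) a p rfl h1 hac h'
      · exact ih _ (by omega) p b rfl h2 h hdb

lemma tri_exists {T : Set (Sym2 (ZMod m))}
    (hTri : Tri m T) (x : ZMod m) (n : ℕ) :
    ∀ a b : ZMod m, b.val - a.val = n → Lk m T a b → a.val < x.val → x.val < b.val →
      ∃ a' b' : ZMod m, a'.val < x.val ∧ x.val < b'.val ∧ Lk m T a' x ∧ Lk m T x b' ∧
        Lk m T a' b' := by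
  induction n using Nat.strong_induction_on with
  | _ n ih =>
    intro a b hn hL hax hxb
    obtain ⟨p, hap, hpb, h1, h2⟩ := hTri a b (by omega) hL
    rcases lt_trichotomy x.val p.val with h | h | h
    · exact ih _ (by omega) a p rfl h1 hax h
    · have := ZMod.val_injective m h
      subst this
      exact ⟨a, b, hap, hpb, h1, h2, hL⟩
    · exact ih _ (by omega) p b rfl h2 h hxb

lemma tri_unique (hm : 3 ≤ m) {T : Set (Sym2 (ZMod m))} (hT : IsDissection m T)
    {a b a' b' x : ZMod m} (h1 : a.val < x.val) (h2 : x.val < b.val) (h3 : Lk m T a x)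
    (h4 : Lk m T x b) (h5 : Lk m T a b) (g1 : a'.val < x.val) (g2 : x.val < b'.val)
    (g3 : Lk m T a' x) (g4 : Lk m T x b') (g5 : Lk m T a' b') : a = a' ∧ b = b' := by
  constructor
  · apply ZMod.val_injective m
    rcases lt_trichotomy a.val a'.val with h | h | h
    · exact (lk_noncross hm hT h3 g5 h g1 g2).elim
    · exact h
    · exact (lk_noncross hm hT g3 h5 h h1 h2).elim
  · apply ZMod.val_injective m
    rcases lt_trichotomy b.val b'.val with h | h | h
    · exact (lk_noncross hm hT h5 g4 h1 h2 h).elim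
    · exact h
    · exact (lk_noncross hm hT g5 h4 g1 g2 h).elim

lemma base_lk (hm : 3 ≤ m) (T : Set (Sym2 (ZMod m))) :
    ∃ z w : ZMod m, z.val = 0 ∧ w.val + 1 = m ∧ Lk m T z w := by
  have hw : ((m - 1 : ℕ) : ZMod m).val = m - 1 := ZMod.val_cast_of_lt (by omega)
  refine ⟨0, ((m - 1 : ℕ) : ZMod m), by simp, by omega, Or.inr ?_⟩
  rw [poly_iff hm _ _ (by simp [hw]; omega)]
  simp [hw]; omega

lemma tri_count (hm : 3 ≤ m) {T : Set (Sym2 (ZMod m))} (hT : IsDissection m T)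
    (hTri : Tri m T) : {C : Finset (ZMod m) | IsCell m T C}.ncard = m - 2 := by
  obtain ⟨z, w, hz, hw, hzw⟩ := base_lk hm T
  have hex : ∀ x : ZMod m, ∃ a b : ZMod m, 0 < x.val → x.val + 1 < m →
      a.val < x.val ∧ x.val < b.val ∧ Lk m T a x ∧ Lk m T x b ∧ Lk m T a b := by
    intro x
    by_cases h : 0 < x.val ∧ x.val + 1 < m
    · obtain ⟨a, b, h'⟩ := tri_exists hTri x _ z w rfl hzw (by omega) (by omega)
      exact ⟨a, b, fun _ _ => h'⟩
    · exact ⟨0, 0, fun h1 h2 => absurd ⟨h1, h2⟩ h⟩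
  choose A B hAB using hex
  have himg : {C : Finset (ZMod m) | IsCell m T C} =
      (fun i : ℕ => ({A i, (i : ZMod m), B i} : Finset (ZMod m))) ''
        (Finset.Ioo 0 (m - 1) : Finset ℕ) := by
    ext C
    simp only [Set.mem_setOf_eq, Set.mem_image, Finset.coe_Ioo, Set.mem_Ioo]
    constructor
    · intro hC
      obtain ⟨a, p, b, h1, h2, h3, h4, h5, rfl⟩ := cell_of_tri hm hT hTri hC
      have bm := ZMod.val_lt b
      refine ⟨p.val, by omega, ?_⟩
      rw [ZMod.natCast_zmod_val]
      obtain ⟨g1, g2, g3, g4, g5⟩ := hAB p (by omega) (by omega)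
      obtain ⟨e1, e2⟩ := tri_unique hm hT h1 h2 h3 h4 h5 g1 g2 g3 g4 g5
      rw [e1, e2]
    · rintro ⟨i, hi, rfl⟩
      have hv : (i : ZMod m).val = i := ZMod.val_cast_of_lt (by omega)
      obtain ⟨g1, g2, g3, g4, g5⟩ := hAB i (by omega) (by omega)
      exact tri_isCell g1 g2 g3 g4 g5 hm hT
  rw [himg, Set.ncard_image_of_injOn, Set.ncard_coe_finset, Nat.card_Ioo]
  · omega
  · intro i hi j hj hij
    simp only [Finset.coe_Ioo, Set.mem_Ioo] at hi hj
    have hv : (i : ZMod m).val = i := ZMod.val_cast_of_lt (by omega)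
    have hv' : (j : ZMod m).val = j := ZMod.val_cast_of_lt (by omega)
    obtain ⟨g1, g2, -⟩ := hAB i (by omega) (by omega)
    obtain ⟨k1, k2, -⟩ := hAB j (by omega) (by omega)
    simp only [Finset.ext_iff, Finset.mem_insert, Finset.mem_singleton,
      ← (ZMod.val_injective m).eq_iff] at hij
    have e1 := hij (A i)
    have e2 := hij i
    have e3 := hij (B i)
    omega

lemma quad_of_cell {D : Set (Sym2 (ZMod m))} {C : Finset (ZMod m)} (hC : IsCell m D C)
    (h4 : C.card = 4) : ∃ p q r t : ZMod m, p.val < q.val ∧ q.val < r.val ∧ r.val < t.val ∧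
      Lk m D p q ∧ Lk m D q r ∧ Lk m D r t ∧ Lk m D p t ∧
      ∀ x, x ∈ C ↔ x = p ∨ x = q ∨ x = r ∨ x = t := by
  have hcard : (C.image ZMod.val).card = 4 := by
    rw [Finset.card_image_of_injective _ (ZMod.val_injective m), h4]
  let f := (C.image ZMod.val).orderEmbOfFin hcard
  have hf : ∀ i, ∃ x ∈ C, x.val = f i := by
    intro i
    have := Finset.orderEmbOfFin_mem (C.image ZMod.val) hcard i
    exact Finset.mem_image.1 this
  choose g hg hgf using hf
  have hall : ∀ x ∈ C, ∃ i, x = g i := by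
    intro x hx
    have : x.val ∈ Set.range f := by
      rw [Finset.range_orderEmbOfFin]; simp only [Finset.coe_image]
      exact ⟨x, hx, rfl⟩
    obtain ⟨i, hi⟩ := this
    exact ⟨i, ZMod.val_injective m (by rw [hgf, hi])⟩
  have l01 : (g 0).val < (g 1).val := by rw [hgf, hgf]; exact f.strictMono (by decide)
  have l12 : (g 1).val < (g 2).val := by rw [hgf, hgf]; exact f.strictMono (by decide)
  have l23 : (g 2).val < (g 3).val := by rw [hgf, hgf]; exact f.strictMono (by decide)
  have hmem : ∀ x, x ∈ C ↔ x = g 0 ∨ x = g 1 ∨ x = g 2 ∨ x = g 3 := by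
    intro x
    constructor
    · intro hx
      obtain ⟨i, rfl⟩ := hall x hx
      fin_cases i <;> simp
    · rintro (rfl | rfl | rfl | rfl) <;> apply hg
  refine ⟨g 0, g 1, g 2, g 3, l01, l12, l23, ?_, ?_, ?_, ?_, hmem⟩
  · apply cell_consec hC (hg _) (hg _) (by omega)
    intro x hx; rw [hmem] at hx
    rcases hx with rfl | rfl | rfl | rfl <;> omega
  · apply cell_consec hC (hg _) (hg _) (by omega)
    intro x hx; rw [hmem] at hx
    rcases hx with rfl | rfl | rfl | rfl <;> omega
  · apply cell_consec hC (hg _) (hg _) (by omega)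
    intro x hx; rw [hmem] at hx
    rcases hx with rfl | rfl | rfl | rfl <;> omega
  · apply cell_minmax hC (hg _) (hg _) (by omega)
    intro x hx; rw [hmem] at hx
    rcases hx with rfl | rfl | rfl | rfl <;> omega

lemma quad_below (hm : 3 ≤ m) {D : Set (Sym2 (ZMod m))} (hD : IsPAngulation m 4 D)
    {a b : ZMod m} (hab : a.val + 1 < b.val) (hL : Lk m D a b) :
    ∃ q r : ZMod m, a.val < q.val ∧ q.val < r.val ∧ r.val < b.val ∧
      Lk m D a q ∧ Lk m D q r ∧ Lk m D r b ∧
      ∃ C, IsCell m D C ∧ a ∈ C ∧ q ∈ C ∧ r ∈ C ∧ b ∈ C := by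
  obtain ⟨C, hC, ha, hb, hle⟩ := cell_below hm hD.1 hab hL
  obtain ⟨p, q, r, t, h1, h2, h3, l1, l2, l3, l4, hmem⟩ := quad_of_cell hC (hD.2 C hC)
  have ep : p = a := by
    apply ZMod.val_injective m
    have := hle p ((hmem p).2 (by simp))
    rcases (hmem a).1 ha with rfl | rfl | rfl | rfl <;> omega
  have et : t = b := by
    apply ZMod.val_injective m
    have := hle t ((hmem t).2 (by simp))
    rcases (hmem b).1 hb with rfl | rfl | rfl | rfl <;> omega
  subst ep et
  exact ⟨q, r, h1, h2, h3, l1, l2, l3, C, hC, ha, (hmem q).2 (by simp), (hmem r).2 (by simp), hb⟩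

lemma lk_parity (hm : 3 ≤ m) (hev : m % 2 = 0) {D : Set (Sym2 (ZMod m))}
    (hD : IsPAngulation m 4 D) (n : ℕ) :
    ∀ a b : ZMod m, b.val - a.val = n → a.val < b.val → Lk m D a b →
      (b.val + a.val) % 2 = 1 := by
  induction n using Nat.strong_induction_on with
  | _ n ih =>
    intro a b hn hab hL
    by_cases h : a.val + 1 < b.val
    · obtain ⟨q, r, h1, h2, h3, l1, l2, l3, -⟩ := quad_below hm hD h hL
      have := ih _ (by omega) a q rfl h1 l1
      have := ih _ (by omega) q r rfl h2 l2
      have := ih _ (by omega) r b rfl h3 l3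
      omega
    · omega

lemma odd_facts (hm : 3 ≤ m) (hev : m % 2 = 0) {D : Set (Sym2 (ZMod m))}
    (hD : IsPAngulation m 4 D) {x y : ZMod m} (hxy : x.val < y.val)
    (h : s(x, y) ∈ oddPairs m D) :
    x.val % 2 = 1 ∧ y.val % 2 = 1 ∧
    (∃ z : ZMod m, x.val < z.val ∧ z.val < y.val ∧ z.val % 2 = 0 ∧ Lk m D x z ∧ Lk m D z y) ∧
    (∀ u w : ZMod m, Lk m D u w →
      ¬ (u.val < x.val ∧ x.val < w.val ∧ w.val < y.val) ∧
      ¬ (x.val < u.val ∧ u.val < y.val ∧ y.val < w.val)) := by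
  obtain ⟨C, a, b, hC, he, ha, hb, hab, hoa, hob⟩ := h
  have hx : x ∈ C ∧ x.val % 2 = 1 ∧ y ∈ C ∧ y.val % 2 = 1 := by
    rw [Sym2.eq_iff] at he
    rcases he with ⟨rfl, rfl⟩ | ⟨rfl, rfl⟩
    · exact ⟨ha, hoa, hb, hob⟩
    · exact ⟨hb, hob, ha, hoa⟩
  clear he ha hb hab hoa hob
  obtain ⟨hxC, hxo, hyC, hyo⟩ := hx
  obtain ⟨p, q, r, t, h1, h2, h3, l1, l2, l3, l4, hmem⟩ := quad_of_cell hC (hD.2 C hC)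
  have par : ∀ u w : ZMod m, u.val < w.val → Lk m D u w → (w.val + u.val) % 2 = 1 :=
    fun u w h h' => lk_parity hm hev hD _ u w rfl h h'
  have p1 := par _ _ h1 l1
  have p2 := par _ _ h2 l2
  have p3 := par _ _ h3 l3
  have nc := @lk_noncross m _ hm D hD.1
  refine ⟨hxo, hyo, ?_⟩
  have cases2 : (x = p ∧ y = r) ∨ (x = q ∧ y = t) := by
    rcases (hmem x).1 hxC with rfl | rfl | rfl | rfl <;>
    rcases (hmem y).1 hyC with rfl | rfl | rfl | rfl <;>
    first | omega | simp
  rcases cases2 with ⟨rfl, rfl⟩ | ⟨rfl, rfl⟩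
  · refine ⟨⟨q, h1, h2, by omega, l1, l2⟩, ?_⟩
    intro u w hL
    refine ⟨fun ⟨k1, k2, k3⟩ => nc hL l4 k1 k2 (by omega), fun ⟨k1, k2, k3⟩ => ?_⟩
    have := par u w (by omega) hL
    rcases lt_trichotomy u.val q.val with h | h | h
    · exact nc l1 hL k1 h (by omega)
    · rcases lt_trichotomy w.val t.val with h' | h' | h'
      · exact nc hL l3 (by omega) k3 h'
      · omega
      · exact nc l4 hL (by omega) (by omega) h'
    · exact nc l2 hL h k2 k3
  · refine ⟨⟨r, h2, h3, by omega, l2, l3⟩, ?_⟩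
    intro u w hL
    refine ⟨fun ⟨k1, k2, k3⟩ => ?_, fun ⟨k1, k2, k3⟩ => nc l4 hL (by omega) k2 k3⟩
    have := par u w (by omega) hL
    rcases lt_trichotomy w.val r.val with h | h | h
    · exact nc hL l2 k1 k2 h
    · rcases lt_trichotomy u.val p.val with h' | h' | h'
      · exact nc hL l4 h' (by omega) (by omega)
      · omega
      · exact nc l1 hL h' k1 (by omega)
    · exact nc hL l3 (by omega) h (by omega)

lemma assoc_noncross (hm : 3 ≤ m) (hev : m % 2 = 0) {D : Set (Sym2 (ZMod m))}
    (hD : IsPAngulation m 4 D) {a b c d : ZMod m} (h1 : s(a, b) ∈ assocTriangulation m D)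
    (h2 : s(c, d) ∈ assocTriangulation m D)
    (hac : a.val < c.val) (hcb : c.val < b.val) (hbd : b.val < d.val) : False := by
  rcases h1 with h1 | h1
  · rcases h2 with h2 | h2
    · exact lk_noncross hm hD.1 (Or.inl h1) (Or.inl h2) hac hcb hbd
    · obtain ⟨-, -, -, h⟩ := odd_facts hm hev hD (by omega) h2
      exact (h a b (Or.inl h1)).1 ⟨hac, hcb, hbd⟩
  · obtain ⟨o1, o2, -, h⟩ := odd_facts hm hev hD (by omega) h1
    rcases h2 with h2 | h2
    · exact (h c d (Or.inl h2)).2 ⟨hac, hcb, hbd⟩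
    · obtain ⟨-, -, ⟨z, z1, z2, z3, z4, z5⟩, -⟩ := odd_facts hm hev hD (by omega) h2
      rcases lt_trichotomy z.val b.val with g | g | g
      · exact (h z d z5).2 ⟨by omega, g, hbd⟩
      · omega
      · exact (h c z z4).2 ⟨hac, hcb, g⟩

lemma assoc_dissection (hm : 3 ≤ m) (hev : m % 2 = 0) {D : Set (Sym2 (ZMod m))}
    (hD : IsPAngulation m 4 D) : IsDissection m (assocTriangulation m D) := by
  have hdiag : ∀ e ∈ assocTriangulation m D, IsDiagonal m e := by
    rintro e (he | ⟨C, a, b, -, rfl, -, -, hab, hoa, hob⟩)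
    · exact hD.1.1 e he
    · unfold IsBlack at hoa hob
      refine ⟨a, b, rfl, hab, ?_, ?_⟩ <;> (rw [ne_eq, eq_succ_iff hm]; omega)
  refine ⟨hdiag, ?_⟩
  intro e he f hf hc
  obtain ⟨a, b, rfl, hab⟩ := sym2_sorted (hdiag e he)
  obtain ⟨c, d, rfl, hcd⟩ := sym2_sorted (hdiag f hf)
  rw [crosses_iff _ _ _ _ hab hcd] at hc
  rcases hc with ⟨k1, k2, k3⟩ | ⟨k1, k2, k3⟩
  · exact assoc_noncross hm hev hD he hf k1 k2 k3
  · exact assoc_noncross hm hev hD hf he k1 k2 k3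

lemma assoc_tri (hm : 3 ≤ m) (hev : m % 2 = 0) {D : Set (Sym2 (ZMod m))}
    (hD : IsPAngulation m 4 D) : Tri m (assocTriangulation m D) := by
  have up : ∀ x y : ZMod m, Lk m D x y → Lk m (assocTriangulation m D) x y :=
    fun x y h => h.imp Or.inl id
  intro a b hab hL
  have hL' : Lk m D a b ∨ s(a, b) ∈ oddPairs m D := by
    rcases hL with (h | h) | h
    · exact Or.inl (Or.inl h)
    · exact Or.inr h
    · exact Or.inl (Or.inr h)
  rcases hL' with h | h
  · obtain ⟨q, r, h1, h2, h3, l1, l2, l3, C, hC, c1, c2, c3, c4⟩ := quad_below hm hD hab h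
    have p1 := lk_parity hm hev hD _ _ _ rfl h1 l1
    have p2 := lk_parity hm hev hD _ _ _ rfl h2 l2
    have p3 := lk_parity hm hev hD _ _ _ rfl h3 l3
    by_cases ho : a.val % 2 = 1
    · refine ⟨r, by omega, h3, Or.inl (Or.inr ⟨C, a, r, hC, rfl, c1, c3, ?_, ho, ?_⟩), up _ _ l3⟩
      · rintro rfl; omega
      · show r.val % 2 = 1
        omega
    · refine ⟨q, h1, by omega, up _ _ l1, Or.inl (Or.inr ⟨C, q, b, hC, rfl, c2, c4, ?_, ?_, ?_⟩)⟩
      · rintro rfl; omega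
      · show q.val % 2 = 1
        omega
      · show b.val % 2 = 1
        omega
  · obtain ⟨-, -, ⟨z, z1, z2, -, z4, z5⟩, -⟩ := odd_facts hm hev hD (by omega) h
    exact ⟨z, z1, z2, up _ _ z4, up _ _ z5⟩

end helpers

/-- For every quadrangulation `D` of the `(2s+2)`-gon, the diagonals of `D`
together with the unique odd–odd diagonal of each quadrilateral form a
triangulation of the `(2s+2)`-gon: a maximal set of pairwise non-crossing
diagonals, dissecting the polygon into `2s` triangles. -/
theorem stmt5 (s : ℕ) (hs : 1 ≤ s) (D : Set (Sym2 (ZMod (2 * s + 2))))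
    (hD : IsPAngulation (2 * s + 2) 4 D) :
    IsDissection (2 * s + 2) (assocTriangulation (2 * s + 2) D) ∧
    (∀ E : Set (Sym2 (ZMod (2 * s + 2))), IsDissection (2 * s + 2) E →
      assocTriangulation (2 * s + 2) D ⊆ E → E = assocTriangulation (2 * s + 2) D) ∧
    (∀ C : Finset (ZMod (2 * s + 2)),
      IsCell (2 * s + 2) (assocTriangulation (2 * s + 2) D) C → C.card = 3) ∧
    {C : Finset (ZMod (2 * s + 2)) |
      IsCell (2 * s + 2) (assocTriangulation (2 * s + 2) D) C}.ncard = 2 * s := by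
  have hm : 3 ≤ 2 * s + 2 := by omega
  have hev : (2 * s + 2) % 2 = 0 := by omega
  have hT := assoc_dissection hm hev hD
  have hTri := assoc_tri hm hev hD
  refine ⟨hT, ?_, ?_, ?_⟩
  · intro E hE hsub
    refine Set.Subset.antisymm ?_ hsub
    intro e he
    obtain ⟨c, d, rfl, hcd⟩ := sym2_sorted (hE.1 e he)
    obtain ⟨z, w, hz, hw, hzw⟩ := base_lk hm (assocTriangulation (2 * s + 2) D)
    have := ZMod.val_lt d
    exact tri_maximal hm hTri hcd (hE.1 _ he) (fun f hf => hE.2 f (hsub hf) _ he) _ z w rfl hzw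
      (by omega) (by omega)
  · intro C hC
    obtain ⟨a, p, b, h1, h2, -, -, -, rfl⟩ := cell_of_tri hm hT hTri hC
    refine Finset.card_eq_three.2 ⟨a, p, b, ?_, ?_, ?_, rfl⟩ <;> (rintro rfl; omega)
  · rw [tri_count hm hT hTri]
    omega

end FriezeNote
end

section
/- Let D be a quadrangulation of the (2s+2)-gon and T_D its associated triangulation. For every vertex α with 0 ≤ α ≤ 2s+1, the number t_α of triangles of T_D incident with α satisfies t_α = q_α if α is even and t_α = 2q_α if α is odd, where q_α is the number of quadrilaterals of D incident with α. -/
namespace FriezeNote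

/-- position of `x` relative to base `β` -/
def P (m : ℕ) (β x : ZMod m) : ℕ := (x - β).val

theorem P_lt (m : ℕ) [NeZero m] (β x : ZMod m) : P m β x < m := ZMod.val_lt _

theorem P_self (m : ℕ) [NeZero m] (β : ZMod m) : P m β β = 0 := by simp [P]

theorem P_inj (m : ℕ) [NeZero m] (β x y : ZMod m) : P m β x = P m β y ↔ x = y := by
  unfold P
  rw [(ZMod.val_injective m).eq_iff, sub_left_inj]

theorem P_ne (m : ℕ) [NeZero m] (β : ZMod m) {x y : ZMod m} (h : x ≠ y) :
    P m β x ≠ P m β y := fun h' => h ((P_inj m β x y).1 h')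

theorem P_base (m : ℕ) [NeZero m] (β a x : ZMod m) :
    (P m β a ≤ P m β x ∧ P m a x = P m β x - P m β a) ∨
    (P m β x < P m β a ∧ P m a x = m + P m β x - P m β a) := by
  have h1 : x - a = (x - β) - (a - β) := by ring
  rcases le_or_gt (P m β a) (P m β x) with h | h
  · left
    refine ⟨h, ?_⟩
    unfold P at *
    rw [h1, ZMod.val_sub h]
  · right
    refine ⟨h, ?_⟩
    have h2 : x - a = -((a - β) - (x - β)) := by ring
    have h3 := P_lt m β a
    unfold P at *
    rw [h2, ZMod.neg_val, if_neg, ZMod.val_sub h.le]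
    · omega
    · intro h0
      rw [sub_eq_zero] at h0
      rw [h0] at h
      omega

theorem sb_iff_s6 (m : ℕ) [NeZero m] (β a x c : ZMod m) : StrictBtw m a x c ↔
    (P m β a < P m β x ∧ P m β x < P m β c) ∨
    (P m β x < P m β c ∧ P m β c < P m β a) ∨
    (P m β c < P m β a ∧ P m β a < P m β x) := by
  change 0 < P m a x ∧ P m a x < P m a c ↔ _
  have := P_base m β a x
  have := P_base m β a c
  have := P_lt m β a
  have := P_lt m β x
  have := P_lt m β c
  omega

theorem P_succ (m : ℕ) [NeZero m] (hm : 2 ≤ m) (a : ZMod m) : P m a (a + 1) = 1 := by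
  have : Fact (1 < m) := ⟨hm⟩
  simp [P, ZMod.val_one]

theorem P_eq_one (m : ℕ) [NeZero m] (hm : 2 ≤ m) (a b : ZMod m) (h : P m a b = 1) :
    b = a + 1 := by
  rw [← P_inj m a, h, P_succ m hm]

theorem gap_exists (m : ℕ) [NeZero m] (C : Finset (ZMod m)) (hC : 2 ≤ C.card) (c : ZMod m)
    (hc : c ∉ C) : ∃ x y, CycConsec m C x y ∧ StrictBtw m x c y := by
  obtain ⟨u, hu, v, hv, huv⟩ := Finset.one_lt_card.1 hC
  have hne : C.Nonempty := ⟨u, hu⟩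
  obtain ⟨x, hx, hxm⟩ := Finset.exists_max_image C (P m c) hne
  obtain ⟨y, hy, hym⟩ := Finset.exists_min_image C (P m c) hne
  have h1 := P_ne m c huv
  have h0 := P_self m c
  have hy0 : P m c y ≠ P m c c := P_ne m c (by rintro rfl; exact hc hy)
  have := hxm u hu
  have := hxm v hv
  have := hym u hu
  have := hym v hv
  refine ⟨x, y, ⟨hx, hy, ?_, ?_⟩, ?_⟩
  · rintro rfl; omega
  · intro z hz
    have := hxm z hz
    have := hym z hz
    rw [sb_iff_s6 m c]; omega
  · rw [sb_iff_s6 m c]; omega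

theorem succ_exists (m : ℕ) [NeZero m] (C : Finset (ZMod m)) (hC : 2 ≤ C.card) (c : ZMod m)
    (hc : c ∈ C) : ∃ y, CycConsec m C c y := by
  have hne : (C.erase c).Nonempty := by
    rw [← Finset.card_pos, Finset.card_erase_of_mem hc]; omega
  obtain ⟨y, hy, hym⟩ := Finset.exists_min_image (C.erase c) (P m c) hne
  rw [Finset.mem_erase] at hy
  refine ⟨y, hc, hy.2, hy.1.symm, ?_⟩
  intro z hz
  rw [sb_iff_s6 m c]
  have h0 := P_self m c
  by_cases hzc : z = c
  · subst hzc; omega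
  · have := hym z (Finset.mem_erase.2 ⟨hzc, hz⟩)
    omega

/-- consecutive in both directions forces two elements. -/
theorem consec_both (m : ℕ) [NeZero m] (C : Finset (ZMod m)) (hC : 3 ≤ C.card) (a b : ZMod m)
    (h1 : CycConsec m C a b) (h2 : CycConsec m C b a) : False := by
  have : C ⊆ {a, b} := by
    intro z hz
    by_contra h
    simp only [Finset.mem_insert, Finset.mem_singleton, not_or] at h
    have e1 := h1.2.2.2 z hz
    have e2 := h2.2.2.2 z hz
    rw [sb_iff_s6 m a] at e1 e2
    have := P_ne m a h.1
    have := P_ne m a h.2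
    have := P_ne m a h1.2.2.1
    have := P_self m a
    omega
  have := Finset.card_le_card this
  have := Finset.card_le_two (a := a) (b := b)
  omega

theorem consec_of_succ (m : ℕ) [NeZero m] (hm : 2 ≤ m) (C : Finset (ZMod m)) (a : ZMod m)
    (h1 : a ∈ C) (h2 : a + 1 ∈ C) : CycConsec m C a (a + 1) := by
  have h0 := P_self m a
  have h3 := P_succ m hm a
  refine ⟨h1, h2, ?_, ?_⟩
  · intro h; rw [← h] at h3; omega
  · intro z _
    rw [sb_iff_s6 m a]; omega

theorem cell_edge (m : ℕ) [NeZero m] (hm : 2 ≤ m) (D : Set (Sym2 (ZMod m)))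
    (C : Finset (ZMod m)) (hC : IsCell m D C) (a b : ZMod m) (h : CycConsec m C a b) :
    s(a, b) ∈ D ∨ b = a + 1 := by
  rcases hC.2.1 a b h with h' | ⟨x, hx⟩
  · exact Or.inl h'
  · right
    rw [Sym2.eq_iff] at hx
    rcases hx with ⟨rfl, rfl⟩ | ⟨rfl, rfl⟩
    · rfl
    · exact (consec_both m C hC.1 _ _ h (consec_of_succ m hm C _ h.2.1 h.1)).elim

theorem cell_edge' (m : ℕ) [NeZero m] (hm : 2 ≤ m) (D : Set (Sym2 (ZMod m)))
    (C : Finset (ZMod m)) (hC : IsCell m D C) (a b c : ZMod m) (h : CycConsec m C a b)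
    (hc : StrictBtw m a c b) : s(a, b) ∈ D := by
  rcases cell_edge m hm D C hC a b h with h' | rfl
  · exact h'
  · have h0 := P_self m a
    have h3 := P_succ m hm a
    rw [sb_iff_s6 m a] at hc
    omega

theorem not_cross (m : ℕ) (D : Set (Sym2 (ZMod m))) (hD : IsDissection m D)
    (a b c d : ZMod m) (h1 : s(a, b) ∈ D) (h2 : s(c, d) ∈ D) (h3 : StrictBtw m a c b)
    (h4 : StrictBtw m b d a) : False :=
  hD.2 _ h1 _ h2 ⟨a, b, c, d, rfl, rfl, h3, h4⟩

theorem key_aux (m : ℕ) [NeZero m] (hm : 2 ≤ m) (D : Set (Sym2 (ZMod m)))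
    (hD : IsDissection m D) (C : Finset (ZMod m)) (hC : IsCell m D C) (u v c d : ZMod m)
    (hu : u ∈ C) (hv : v ∈ C) (hcd : s(c, d) ∈ D) (h1 : StrictBtw m c u d)
    (h2 : StrictBtw m d v c) (hc : c ∉ C) : False := by
  obtain ⟨x, y, hxy, hs⟩ := gap_exists m C (by have := hC.1; omega) c hc
  have hxD := cell_edge' m hm D C hC x y c hxy hs
  have e1 := hxy.2.2.2 u hu
  have e2 := hxy.2.2.2 v hv
  have h5 : ¬ StrictBtw m y d x := fun h => not_cross m D hD x y c d hxD hcd hs h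
  rw [sb_iff_s6 m c] at *
  have := P_self m c
  omega

theorem key (m : ℕ) [NeZero m] (hm : 2 ≤ m) (D : Set (Sym2 (ZMod m)))
    (hD : IsDissection m D) (C : Finset (ZMod m)) (hC : IsCell m D C) (u v c d : ZMod m)
    (hu : u ∈ C) (hv : v ∈ C) (hcd : s(c, d) ∈ D) (h1 : StrictBtw m c u d)
    (h2 : StrictBtw m d v c) : False := by
  by_cases hc : c ∈ C
  · by_cases hd : d ∈ C
    · rcases hC.2.2 c d hc hd hcd with h | h
      · exact h.2.2.2 u hu h1
      · exact h.2.2.2 v hv h2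
    · exact key_aux m hm D hD C hC v u d c hv hu (by rwa [Sym2.eq_swap]) h2 h1 hd
  · exact key_aux m hm D hD C hC u v c d hu hv hcd h1 h2 hc

/-- A vertex of `C'` in a gap of `C` forces common vertices to be endpoints of that gap. -/
theorem gap_cells (m : ℕ) [NeZero m] (hm : 2 ≤ m) (D : Set (Sym2 (ZMod m)))
    (hD : IsDissection m D) (C C' : Finset (ZMod m)) (hC : IsCell m D C) (hC' : IsCell m D C')
    (x' : ZMod m) (hx' : x' ∈ C') (hx : x' ∉ C) :
    ∃ c d, CycConsec m C c d ∧ StrictBtw m c x' d ∧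
      ∀ z, z ∈ C → z ∈ C' → z = c ∨ z = d := by
  obtain ⟨c, d, hcd, hs⟩ := gap_exists m C (by have := hC.1; omega) x' hx
  refine ⟨c, d, hcd, hs, ?_⟩
  intro z hz hz'
  by_contra h
  rw [not_or] at h
  have hxD := cell_edge' m hm D C hC c d x' hcd hs
  apply key m hm D hD C' hC' x' z c d hx' hz' hxD hs
  have e := hcd.2.2.2 z hz
  rw [sb_iff_s6 m c] at *
  have := P_self m c
  have := P_ne m c h.1
  have := P_ne m c h.2
  omega

theorem cell_sub_of_consec (m : ℕ) [NeZero m] (hm : 2 ≤ m) (D : Set (Sym2 (ZMod m)))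
    (hD : IsDissection m D) (C C' : Finset (ZMod m)) (hC : IsCell m D C) (hC' : IsCell m D C')
    (a b : ZMod m) (h : CycConsec m C a b) (h' : CycConsec m C' a b) : C' ⊆ C := by
  intro x' hx'
  by_contra hx
  obtain ⟨c, d, hcd, hs, hz⟩ := gap_cells m hm D hD C C' hC hC' x' hx' hx
  rcases hz a h.1 h'.1 with rfl | rfl
  · rcases hz b h.2.1 h'.2.1 with rfl | rfl
    · exact h.2.2.1 rfl
    · exact h'.2.2.2 _ hx' hs
  · rcases hz b h.2.1 h'.2.1 with rfl | rfl
    · exact consec_both m C hC.1 _ _ h hcd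
    · exact h.2.2.1 rfl

theorem cell_sub_of_diag (m : ℕ) [NeZero m] (hm : 2 ≤ m) (D : Set (Sym2 (ZMod m)))
    (hD : IsDissection m D) (C C' : Finset (ZMod m)) (hC : IsCell m D C) (hC' : IsCell m D C')
    (a b : ZMod m) (ha : a ∈ C) (hb : b ∈ C) (ha' : a ∈ C') (hb' : b ∈ C') (hab : a ≠ b)
    (h1 : ¬ CycConsec m C a b) (h2 : ¬ CycConsec m C b a) : C' ⊆ C := by
  intro x' hx'
  by_contra hx
  obtain ⟨c, d, hcd, hs, hz⟩ := gap_cells m hm D hD C C' hC hC' x' hx' hx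
  rcases hz a ha ha' with rfl | rfl <;> rcases hz b hb hb' with rfl | rfl <;> simp_all

/-- Existence of the cell on the left of an edge. -/
theorem cell_exists (m : ℕ) [NeZero m] (hm : 3 ≤ m) (D : Set (Sym2 (ZMod m)))
    (hD : IsDissection m D) (a b : ZMod m) (hab : s(a, b) ∈ D ∨ b = a + 1) :
    ∃ C, IsCell m D C ∧ CycConsec m C a b := by
  classical
  have hL : 2 ≤ P m b a := by
    have h0 := P_self m b
    have h0' := P_self m a
    have hb := P_base m b a b
    have hlt := P_lt m b a
    rcases hab with h | rfl
    · obtain ⟨x, y, he, h1, h2, h3⟩ := hD.1 _ h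
      rw [Sym2.eq_iff] at he
      have hne : a ≠ b ∧ a ≠ b + 1 := by
        rcases he with ⟨rfl, rfl⟩ | ⟨rfl, rfl⟩
        · exact ⟨h1, h3⟩
        · exact ⟨h1.symm, h2⟩
      have := P_ne m b hne.1
      have : ¬ P m b a = 1 := fun h => hne.2 (P_eq_one m (by omega) b a h)
      omega
    · have := P_succ m (by omega) a
      have := P_base m (a+1) a (a+1)
      omega
  set p := P m b with hp
  have hpb : p b = 0 := P_self m b
  have hab' : a ≠ b := by rintro rfl; omega
  -- covering edges
  let Cov : ZMod m → ZMod m → Prop := fun u v =>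
    s(u, v) ∈ D ∧ p u < p v ∧ p v ≤ p a ∧ ¬ (u = b ∧ v = a)
  let C : Finset (ZMod m) := Finset.univ.filter fun x =>
    p x ≤ p a ∧ ∀ u v, Cov u v → ¬ (p u < p x ∧ p x < p v)
  have memC : ∀ x, x ∈ C ↔ p x ≤ p a ∧ ∀ u v, Cov u v → ¬ (p u < p x ∧ p x < p v) := by
    intro x; simp [C]
  have haC : a ∈ C := by
    rw [memC]; refine ⟨le_rfl, ?_⟩
    rintro u v ⟨_, _, h, _⟩; omega
  have hbC : b ∈ C := by
    rw [memC]; refine ⟨by omega, ?_⟩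
    rintro u v ⟨_, _, h, _⟩; omega
  have hcon : CycConsec m C a b := by
    refine ⟨haC, hbC, hab', ?_⟩
    intro x hx
    rw [memC] at hx
    rw [sb_iff_s6 m b]
    change ¬ ((p a < p x ∧ p x < p b) ∨ (p x < p b ∧ p b < p a) ∨ (p b < p a ∧ p a < p x))
    omega
  -- main claim
  have main : ∀ x y, x ∈ C → y ∈ C → p x + 1 < p y →
      (∀ z ∈ C, ¬ (p x < p z ∧ p z < p y)) → Cov x y := by
    intro x y hx hy hxy hno
    have hya := ((memC y).1 hy).1
    have uncov : ∀ z, p x < p z → p z < p y → ∃ u v, Cov u v ∧ p u < p z ∧ p z < p v := by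
      intro z h1 h2
      by_contra hcon
      push Not at hcon
      refine hno z ((memC z).2 ⟨by omega, ?_⟩) ⟨h1, h2⟩
      intro u v huv h
      have := hcon u v huv h.1
      omega
    have hx1 : p (x + 1) = p x + 1 := by
      have := P_succ m (by omega) x
      have := P_base m b x (x + 1)
      have := P_lt m b y
      simp only [← hp] at *
      omega
    obtain ⟨u, v, huv, h1, h2⟩ := uncov (x + 1) (by omega) (by omega)
    have hux : u = x := by
      have := ((memC x).1 hx).2 u v huv
      apply (P_inj m b u x).1
      change p u = p x
      omega
    subst hux
    have hne : (Finset.univ.filter fun w => Cov u w).Nonempty := ⟨v, by simp [huv]⟩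
    obtain ⟨w, hw, hwm⟩ := Finset.exists_max_image _ p hne
    simp only [Finset.mem_filter, Finset.mem_univ, true_and] at hw hwm
    have hvw := hwm v huv
    have hwy : p w ≤ p y := by
      have := ((memC y).1 hy).2 u w hw
      omega
    rcases hwy.eq_or_lt with h | h
    · have : w = y := (P_inj m b w y).1 h
      exact this ▸ hw
    · exfalso
      obtain ⟨u', v', hc', h3, h4⟩ := uncov w (by omega) h
      have h5 := ((memC u).1 hx).2 u' v' hc'
      have h6 : ¬ (p u < p u') := by
        intro h7
        refine not_cross m D hD u w u' v' hw.1 hc'.1 ?_ ?_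
        · rw [sb_iff_s6 m b]; simp only [← hp]; omega
        · rw [sb_iff_s6 m b]; simp only [← hp]; omega
      have hu' : u' = u := by
        apply (P_inj m b u' u).1
        change p u' = p u
        omega
      subst hu'
      have := hwm v' hc'
      omega
  refine ⟨C, ⟨?_, ?_, ?_⟩, hcon⟩
  · by_contra hcard
    have hsub : ∀ z ∈ C, z = b ∨ z = a := by
      intro z hz
      by_contra h
      rw [not_or] at h
      apply hcard
      have : ({a, b, z} : Finset (ZMod m)) ⊆ C := by
        intro t ht
        simp only [Finset.mem_insert, Finset.mem_singleton] at ht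
        rcases ht with rfl | rfl | rfl <;> assumption
      have h3 : ({a, b, z} : Finset (ZMod m)).card = 3 :=
        Finset.card_eq_three.2 ⟨a, b, z, hab', Ne.symm h.2, Ne.symm h.1, rfl⟩
      have := Finset.card_le_card this
      omega
    have := main b a hbC haC (by omega) (by
      intro z hz
      rcases hsub z hz with rfl | rfl <;> omega)
    exact this.2.2.2 ⟨rfl, rfl⟩
  · rintro x y ⟨hx, hy, hne, hno⟩
    have hxa := ((memC x).1 hx).1
    have hya := ((memC y).1 hy).1
    have hne' : p x ≠ p y := P_ne m b hne
    simp only [sb_iff_s6 m b, ← hp] at hno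
    rcases lt_or_gt_of_ne hne' with h | h
    · by_cases h1 : p y = p x + 1
      · right
        have := P_base m b x y
        have := P_eq_one m (by omega) x y (by simp only [← hp] at *; omega)
        exact ⟨x, by rw [this]⟩
      · left
        refine (main x y hx hy (by omega) ?_).1
        intro z hz
        have := hno z hz
        omega
    · have h1 : x = a := by
        apply (P_inj m b x a).1
        change p x = p a
        have := hno a haC
        omega
      have h2 : y = b := by
        apply (P_inj m b y b).1
        change p y = p b
        have := hno b hbC
        omega
      subst h1 h2
      rcases hab with h | h
      · exact Or.inl h
      · exact Or.inr ⟨x, by rw [← h]⟩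
  · have aux : ∀ x y, x ∈ C → y ∈ C → s(x, y) ∈ D → p x < p y →
      (CycConsec m C x y ∨ CycConsec m C y x) := by
      intro x y hx hy hxy hlt
      have hya := ((memC y).1 hy).1
      by_cases h : x = b ∧ y = a
      · rw [h.1, h.2]; exact Or.inr hcon
      · left
        refine ⟨hx, hy, by rintro rfl; omega, ?_⟩
        intro z hz
        have := ((memC z).1 hz).2 x y ⟨hxy, hlt, hya, h⟩
        rw [sb_iff_s6 m b]; simp only [← hp]; omega
    intro x y hx hy hxy
    have hne : x ≠ y := by
      rintro rfl
      obtain ⟨x', y', he, h1, _⟩ := hD.1 _ hxy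
      rw [Sym2.eq_iff] at he
      rcases he with ⟨rfl, rfl⟩ | ⟨rfl, rfl⟩ <;> exact h1 rfl
    have hne' : p x ≠ p y := P_ne m b hne
    rcases lt_or_gt_of_ne hne' with h | h
    · exact aux x y hx hy hxy h
    · exact (aux y x hy hx (by rwa [Sym2.eq_swap]) h).symm

theorem diss_ne (m : ℕ) (D : Set (Sym2 (ZMod m))) (hD : IsDissection m D) (a b : ZMod m)
    (h : s(a, b) ∈ D) : a ≠ b ∧ b ≠ a + 1 ∧ a ≠ b + 1 := by
  obtain ⟨x, y, he, h1, h2, h3⟩ := hD.1 _ h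
  rw [Sym2.eq_iff] at he
  rcases he with ⟨rfl, rfl⟩ | ⟨rfl, rfl⟩
  · exact ⟨h1, h2, h3⟩
  · exact ⟨h1.symm, h3, h2⟩

theorem ncard_rel {A B : Type*} (S : Set A) (T : Set B) (R : A → B → Prop)
    (h1 : ∀ a ∈ S, ∃ b ∈ T, R a b) (h2 : ∀ b ∈ T, ∃ a ∈ S, R a b)
    (h3 : ∀ a ∈ S, ∀ b b', R a b → R a b' → b = b')
    (h4 : ∀ a ∈ S, ∀ a' ∈ S, ∀ b, R a b → R a' b → a = a') : S.ncard = T.ncard := by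
  choose f hf hR using h1
  apply Set.ncard_congr f
  · exact hf
  · intro a b ha hb h
    exact h4 a ha b hb (f a ha) (hR a ha) (h ▸ hR b hb)
  · intro b hb
    obtain ⟨a, ha, hab⟩ := h2 b hb
    exact ⟨a, ha, h3 a ha _ _ (hR a ha) hab⟩

theorem consec_unique (m : ℕ) [NeZero m] (C : Finset (ZMod m)) (a b b' : ZMod m)
    (h : CycConsec m C a b) (h' : CycConsec m C a b') : b = b' := by
  by_contra hne
  have e1 := h.2.2.2 b' h'.2.1
  have e2 := h'.2.2.2 b h.2.1
  rw [sb_iff_s6 m a] at e1 e2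
  have := P_ne m a hne
  have := P_ne m a h.2.2.1
  have := P_ne m a h'.2.2.1
  have := P_self m a
  omega

theorem cellCount_eq (m : ℕ) [NeZero m] (hm : 3 ≤ m) (D : Set (Sym2 (ZMod m)))
    (hD : IsDissection m D) (α : ZMod m) :
    cellCount m D α = {b | s(α, b) ∈ D}.ncard + 1 := by
  have hm2 : 2 ≤ m := by omega
  have h1 : cellCount m D α = (insert (α + 1) {b | s(α, b) ∈ D}).ncard := by
    unfold cellCount
    apply ncard_rel _ _ (fun C b => CycConsec m C α b)
    · rintro C ⟨hC, hα⟩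
      obtain ⟨y, hy⟩ := succ_exists m C (by have := hC.1; omega) α hα
      refine ⟨y, ?_, hy⟩
      rcases cell_edge m hm2 D C hC α y hy with h | h
      · exact Or.inr h
      · exact Or.inl h
    · intro b hb
      obtain ⟨C, hC, h⟩ := cell_exists m hm D hD α b (Or.symm hb)
      exact ⟨C, ⟨hC, h.1⟩, h⟩
    · intro C _ b b' h h'
      exact consec_unique m C α b b' h h'
    · rintro C ⟨hC, _⟩ C' ⟨hC', _⟩ b h h'
      exact (cell_sub_of_consec m hm2 D hD C' C hC' hC α b h' h).antisymm
        (cell_sub_of_consec m hm2 D hD C C' hC hC' α b h h')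
  rw [h1, Set.ncard_insert_of_notMem _ (Set.toFinite _)]
  intro h
  exact (diss_ne m D hD _ _ h).2.1 rfl

/-- Structure of four-element sets. -/
theorem quad_struct (m : ℕ) [NeZero m] (C : Finset (ZMod m)) (hC : C.card = 4) (α : ZMod m)
    (hα : α ∈ C) : ∃ x y z, P m α α < P m α x ∧ P m α x < P m α y ∧ P m α y < P m α z ∧
      ∀ t, t ∈ C ↔ t = α ∨ t = x ∨ t = y ∨ t = z := by
  have hc : (C.erase α).card = 3 := by rw [Finset.card_erase_of_mem hα, hC]
  obtain ⟨x, y, z, hxy, hxz, hyz, h⟩ := Finset.card_eq_three.1 hc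
  have hm : ∀ t, t ∈ C ↔ t = α ∨ t = x ∨ t = y ∨ t = z := by
    intro t
    rw [← Finset.insert_erase hα, h]
    simp
  have hn : ∀ t ∈ C.erase α, P m α t ≠ P m α α := fun t ht =>
    P_ne m α (Finset.mem_erase.1 ht).1
  have nx := hn x (by simp [h])
  have ny := hn y (by simp [h])
  have nz := hn z (by simp [h])
  have n1 := P_ne m α hxy
  have n2 := P_ne m α hxz
  have n3 := P_ne m α hyz
  have h0 := P_self m α
  rcases lt_or_gt_of_ne n1 with h1 | h1 <;> rcases lt_or_gt_of_ne n2 with h2 | h2 <;>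
    rcases lt_or_gt_of_ne n3 with h3 | h3
  · exact ⟨x, y, z, by omega, by omega, by omega, fun t => by rw [hm]⟩
  · exact ⟨x, z, y, by omega, by omega, by omega, fun t => by rw [hm]; tauto⟩
  · omega
  · exact ⟨z, x, y, by omega, by omega, by omega, fun t => by rw [hm]; tauto⟩
  · exact ⟨y, x, z, by omega, by omega, by omega, fun t => by rw [hm]; tauto⟩
  · omega
  · exact ⟨y, z, x, by omega, by omega, by omega, fun t => by rw [hm]; tauto⟩
  · exact ⟨z, y, x, by omega, by omega, by omega, fun t => by rw [hm]; tauto⟩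

theorem quad_consec (m : ℕ) [NeZero m] (C : Finset (ZMod m)) (α x y z : ZMod m)
    (h1 : P m α α < P m α x) (h2 : P m α x < P m α y) (h3 : P m α y < P m α z)
    (h : ∀ t, t ∈ C ↔ t = α ∨ t = x ∨ t = y ∨ t = z) :
    CycConsec m C α x ∧ CycConsec m C x y ∧ CycConsec m C y z ∧ CycConsec m C z α ∧
    ¬ CycConsec m C α y ∧ ¬ CycConsec m C y α := by
  have hx : x ∈ C := by rw [h]; tauto
  have hy : y ∈ C := by rw [h]; tauto
  have hz : z ∈ C := by rw [h]; tauto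
  have hα : α ∈ C := by rw [h]; tauto
  refine ⟨⟨hα, hx, by rintro rfl; omega, ?_⟩, ⟨hx, hy, by rintro rfl; omega, ?_⟩,
    ⟨hy, hz, by rintro rfl; omega, ?_⟩, ⟨hz, hα, by rintro rfl; omega, ?_⟩, ?_, ?_⟩
  · intro t ht; rw [sb_iff_s6 m α]
    rcases (h t).1 ht with rfl | rfl | rfl | rfl <;> omega
  · intro t ht; rw [sb_iff_s6 m α]
    rcases (h t).1 ht with rfl | rfl | rfl | rfl <;> omega
  · intro t ht; rw [sb_iff_s6 m α]
    rcases (h t).1 ht with rfl | rfl | rfl | rfl <;> omega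
  · intro t ht; rw [sb_iff_s6 m α]
    rcases (h t).1 ht with rfl | rfl | rfl | rfl <;> omega
  · intro hh
    have := hh.2.2.2 x hx
    rw [sb_iff_s6 m α] at this; omega
  · intro hh
    have := hh.2.2.2 z hz
    rw [sb_iff_s6 m α] at this; omega

theorem edge_odd (m : ℕ) [NeZero m] (hm : 3 ≤ m) (D : Set (Sym2 (ZMod m)))
    (hD : IsPAngulation m 4 D) : ∀ (n : ℕ) (a b : ZMod m), P m a b = n →
    (s(a, b) ∈ D ∨ b = a + 1) → n % 2 = 1 := by
  have hm2 : 2 ≤ m := by omega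
  intro n
  induction n using Nat.strong_induction_on with
  | _ n ih =>
    intro a b hn hab
    rcases hab with hab | rfl
    · obtain ⟨C, hC, hcon⟩ := cell_exists m hm D hD.1 b a (Or.inl (by rwa [Sym2.eq_swap]))
      obtain ⟨x, y, z, h1, h2, h3, h⟩ := quad_struct m C (hD.2 C hC) a hcon.2.1
      obtain ⟨c1, c2, c3, c4, -, -⟩ := quad_consec m C a x y z h1 h2 h3 h
      have hbz : b = z := by
        rcases (h b).1 hcon.1 with rfl | rfl | rfl | rfl
        · exact (hcon.2.2.1 rfl).elim
        · exact (consec_both m C hC.1 _ _ hcon c1).elim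
        · exfalso
          have := hcon.2.2.2 z c4.1
          rw [sb_iff_s6 m a] at this; omega
        · rfl
      subst hbz
      have h0 := P_self m a
      have b1 := P_base m a x y
      have b2 := P_base m a y b
      have i1 := ih _ (by omega) a x rfl (cell_edge m hm2 D C hC _ _ c1)
      have i2 := ih _ (by omega) x y rfl (cell_edge m hm2 D C hC _ _ c2)
      have i3 := ih _ (by omega) y b rfl (cell_edge m hm2 D C hC _ _ c3)
      omega
    · rw [P_succ m hm2] at hn; omega

theorem black_iff (m : ℕ) (a : ZMod m) : IsBlack m a ↔ P m 0 a % 2 = 1 := by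
  simp [IsBlack, P]

theorem edge_black (m : ℕ) [NeZero m] (hm : 3 ≤ m) (he : m % 2 = 0) (D : Set (Sym2 (ZMod m)))
    (hD : IsPAngulation m 4 D) (a b : ZMod m) (h : s(a, b) ∈ D ∨ b = a + 1) :
    IsBlack m b ↔ ¬ IsBlack m a := by
  have h1 := edge_odd m hm D hD _ a b rfl h
  have h2 := P_base m 0 a b
  have := P_lt m 0 a
  rw [black_iff, black_iff]
  omega

/-- For a cell and a black vertex of it, there is a unique opposite black vertex. -/
theorem cell_black (m : ℕ) [NeZero m] (hm : 3 ≤ m) (he : m % 2 = 0) (D : Set (Sym2 (ZMod m)))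
    (hD : IsPAngulation m 4 D) (C : Finset (ZMod m)) (hC : IsCell m D C) (a : ZMod m)
    (ha : a ∈ C) (hb : IsBlack m a) : ∃ y ∈ C, y ≠ a ∧ IsBlack m y ∧
      ¬ CycConsec m C a y ∧ ¬ CycConsec m C y a ∧
      ∀ t ∈ C, IsBlack m t → t = a ∨ t = y := by
  have hm2 : 2 ≤ m := by omega
  obtain ⟨x, y, z, h1, h2, h3, h⟩ := quad_struct m C (hD.2 C hC) a ha
  obtain ⟨c1, c2, c3, c4, n1, n2⟩ := quad_consec m C a x y z h1 h2 h3 h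
  have e1 := edge_black m hm he D hD _ _ (cell_edge m hm2 D C hC _ _ c1)
  have e2 := edge_black m hm he D hD _ _ (cell_edge m hm2 D C hC _ _ c2)
  have e3 := edge_black m hm he D hD _ _ (cell_edge m hm2 D C hC _ _ c3)
  refine ⟨y, c3.1, by rintro rfl; omega, by tauto, n1, n2, ?_⟩
  intro t ht hbt
  rcases (h t).1 ht with rfl | rfl | rfl | rfl
  · exact Or.inl rfl
  · tauto
  · exact Or.inr rfl
  · tauto

theorem odd_mem (m : ℕ) (D : Set (Sym2 (ZMod m))) (a b : ZMod m) (h : s(a, b) ∈ oddPairs m D) :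
    ∃ C, IsCell m D C ∧ a ∈ C ∧ b ∈ C ∧ a ≠ b ∧ IsBlack m a ∧ IsBlack m b := by
  obtain ⟨C, x, y, hC, he, hx, hy, hne, bx, bY⟩ := h
  rw [Sym2.eq_iff] at he
  rcases he with ⟨rfl, rfl⟩ | ⟨rfl, rfl⟩
  · exact ⟨C, hC, hx, hy, hne, bx, bY⟩
  · exact ⟨C, hC, hy, hx, hne.symm, bY, bx⟩

theorem assoc_diss (m : ℕ) [NeZero m] (hm : 3 ≤ m) (he : m % 2 = 0) (D : Set (Sym2 (ZMod m)))
    (hD : IsPAngulation m 4 D) : IsDissection m (assocTriangulation m D) := by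
  have hm2 : 2 ≤ m := by omega
  constructor
  · rintro e (h | ⟨C, a, b, hC, rfl, ha, hb, hne, b1, b2⟩)
    · exact hD.1.1 e h
    · refine ⟨a, b, rfl, hne, ?_, ?_⟩
      · intro h
        exact (edge_black m hm he D hD a b (Or.inr h)).1 b2 b1
      · intro h
        exact (edge_black m hm he D hD b a (Or.inr h)).1 b1 b2
  · rintro e h1 f h2 ⟨a, b, c, d, rfl, rfl, s1, s2⟩
    have s3 : StrictBtw m c b d ∧ StrictBtw m d a c := by
      rw [sb_iff_s6 m a] at *
      rw [sb_iff_s6 m a]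
      have := P_self m a
      omega
    rcases h1 with h1 | h1 <;> rcases h2 with h2 | h2
    · exact not_cross m D hD.1 a b c d h1 h2 s1 s2
    · obtain ⟨C, hC, hc, hd, -⟩ := odd_mem m D c d h2
      exact key m hm2 D hD.1 C hC c d a b hc hd h1 s1 s2
    · obtain ⟨C, hC, ha, hb, -⟩ := odd_mem m D a b h1
      exact key m hm2 D hD.1 C hC b a c d hb ha h2 s3.1 s3.2
    · obtain ⟨C, hC, ha, hb, hab, ba, bb⟩ := odd_mem m D a b h1
      obtain ⟨C', hC', hc, hd, hcd, bc, bd⟩ := odd_mem m D c d h2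
      obtain ⟨y, -, -, -, -, -, huniq⟩ := cell_black m hm he D hD C hC a ha ba
      have hy : b = y := (huniq b hb bb).resolve_left hab.symm
      subst hy
      have hcC : c ∉ C := by
        intro h
        have h0 := P_self m a
        rw [sb_iff_s6 m a] at s1
        rcases huniq c h bc with rfl | rfl <;> omega
      have hdC : d ∉ C := by
        intro h
        have h0 := P_self m a
        rw [sb_iff_s6 m a] at s2
        rcases huniq d h bd with rfl | rfl <;> omega
      obtain ⟨p, q, hpq, hs⟩ := gap_exists m C (by have := hC.1; omega) c hcC
      have hpD := cell_edge' m hm2 D C hC p q c hpq hs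
      have k : ¬ StrictBtw m q d p := fun hh =>
        key m hm2 D hD.1 C' hC' c d p q hc hd hpD hs hh
      have e1 := hpq.2.2.2 a ha
      have e2 := hpq.2.2.2 b hb
      have d1 : d ≠ p := by rintro rfl; exact hdC hpq.1
      have d2 : d ≠ q := by rintro rfl; exact hdC hpq.2.1
      have d3 := P_ne m a d1
      have d4 := P_ne m a d2
      have d5 := P_ne m a hpq.2.2.1
      have d6 := P_self m a
      rw [sb_iff_s6 m a] at s1 s2 hs k e1 e2
      omega

/-- For a quadrangulation `D` of the `(2s+2)`-gon and its associated
triangulation `T_D`, the number `t_α` of triangles of `T_D` incident with a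
vertex `α` is `q_α` for even `α` and `2 q_α` for odd `α`, where `q_α` is the
number of quadrilaterals of `D` incident with `α`. -/
theorem stmt6 (s : ℕ) (hs : 1 ≤ s) (D : Set (Sym2 (ZMod (2 * s + 2))))
    (hD : IsPAngulation (2 * s + 2) 4 D) (α : ZMod (2 * s + 2)) :
    (¬ IsBlack (2 * s + 2) α →
      cellCount (2 * s + 2) (assocTriangulation (2 * s + 2) D) α =
        cellCount (2 * s + 2) D α) ∧
    (IsBlack (2 * s + 2) α →
      cellCount (2 * s + 2) (assocTriangulation (2 * s + 2) D) α =
        2 * cellCount (2 * s + 2) D α) := by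
  have hm : 3 ≤ 2 * s + 2 := by omega
  have he : (2 * s + 2) % 2 = 0 := by omega
  have hT := assoc_diss (2 * s + 2) hm he D hD
  rw [cellCount_eq _ hm _ hT]
  constructor
  · intro hα
    rw [cellCount_eq _ hm _ hD.1]
    congr 2
    ext b
    constructor
    · rintro (h | h)
      · exact h
      · obtain ⟨C, -, -, -, -, h1, -⟩ := odd_mem _ D α b h
        exact (hα h1).elim
    · intro h; exact Or.inl h
  · intro hα
    have h1 : cellCount (2 * s + 2) D α = {b | s(α, b) ∈ oddPairs (2 * s + 2) D}.ncard := by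
      unfold cellCount
      apply ncard_rel _ _ (fun C b => b ∈ C ∧ b ≠ α ∧ IsBlack (2 * s + 2) b)
      · rintro C ⟨hC, hα'⟩
        obtain ⟨y, hy, hne, hb, -⟩ := cell_black _ hm he D hD C hC α hα' hα
        exact ⟨y, ⟨C, α, y, hC, rfl, hα', hy, hne.symm, hα, hb⟩, hy, hne, hb⟩
      · intro b hb
        obtain ⟨C, hC, h1, h2, h3, h4, h5⟩ := odd_mem _ D α b hb
        exact ⟨C, ⟨hC, h1⟩, h2, h3.symm, h5⟩
      · rintro C ⟨hC, hα'⟩ b b' ⟨h1, h2, h3⟩ ⟨h1', h2', h3'⟩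
        obtain ⟨y, -, -, -, -, -, hu⟩ := cell_black _ hm he D hD C hC α hα' hα
        rw [(hu b h1 h3).resolve_left h2, (hu b' h1' h3').resolve_left h2']
      · rintro C ⟨hC, hα'⟩ C' ⟨hC', hα''⟩ b ⟨h1, h2, h3⟩ ⟨h1', h2', h3'⟩
        obtain ⟨y, hy, hya, hyb, n1, n2, hu⟩ := cell_black _ hm he D hD C hC α hα' hα
        have hby := (hu b h1 h3).resolve_left h2
        subst hby
        have hsub := cell_sub_of_diag _ (by omega) D hD.1 C C' hC hC' α b hα' h1 hα'' h1'
          h2.symm n1 n2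
        exact (Finset.eq_of_subset_of_card_le hsub
          (by rw [hD.2 C hC, hD.2 C' hC'])).symm
    have h2 : {b | s(α, b) ∈ assocTriangulation (2 * s + 2) D} =
        {b | s(α, b) ∈ D} ∪ {b | s(α, b) ∈ oddPairs (2 * s + 2) D} := rfl
    rw [h2, Set.ncard_union_eq ?_ (Set.toFinite _) (Set.toFinite _), ← h1,
      cellCount_eq _ hm _ hD.1]
    · omega
    · rw [Set.disjoint_left]
      intro b hb hb'
      obtain ⟨C, hC, -, -, -, h4, h5⟩ := odd_mem _ D α b hb'
      exact (edge_black _ hm he D hD α b (Or.inl hb)).1 h5 h4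

end FriezeNote
end
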